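/- Let H be a finite-dimensional complex inner product space, U a unitary operator on H, and ψ ∈ H a unit vector. Let Π₀ and Π₁ be orthogonal projections on H with Π₀Π₁ = 0, and set Π := Π₀ + Π₁. Let G₀ and G₁ be unitary operators on H with G₀Π₀ = Π₀G₀ and G₁Π₁ = Π₁G₁, and define G := Π₀G₀ + Π₁G₁ + (1 − Π) and G̃₀ := Π₀G₀ + (1 − Π₀). For each integer t ≥ 0 define ε(t) := max over integers q, r, s with 0 ≤ q, r, s ≤ t of ‖Π₁ U^q Π₀ (G̃₀)^r (U G̃₀)^s Π₀ ψ‖. Then for every integer t ≥ 0 one has ‖(U G)^t Π₀ ψ − (U G̃₀)^t Π₀ ψ‖ ≤ 2 t² · ε(t). -/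

import Mathlib

/-- A unitary acting on the range of a commuting orthogonal projection, extended by the identity
on the complement, is unitary. -/
theorem mul_add_one_sub_mem_unitary {R : Type*} [Ring R] [StarRing R] {P V : R}
    (hV : V ∈ unitary R) (hP : IsIdempotentElem P) (hPsa : IsSelfAdjoint P)
    (hc : V * P = P * V) : P * V + (1 - P) ∈ unitary R := by
  obtain ⟨h₁, h₂⟩ := Unitary.mem_iff.1 hV
  have hc' : P * star V = star V * P := by
    simpa [hPsa.star_eq] using congrArg star hc
  have hs : star (P * V + (1 - P)) = star V * P + (1 - P) := by
    simp [hPsa.star_eq]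
  have hPP : P * P = P := hP
  rw [Unitary.mem_iff, hs]
  constructor
  · have h₃ : star V * P * (P * V) = P := by
      rw [← mul_assoc, mul_assoc (star V), hPP, mul_assoc, ← hc, ← mul_assoc, h₁, one_mul]
    have h₄ : star V * P * (1 - P) = 0 := by
      rw [mul_assoc, mul_sub, mul_one, hPP, sub_self, mul_zero]
    have h₅ : (1 - P) * (P * V) = 0 := by
      rw [← mul_assoc, sub_mul, one_mul, hPP, sub_self, zero_mul]
    rw [mul_add, add_mul, add_mul, h₃, h₄, h₅, hP.one_sub.eq]
    abel
  · have h₃ : P * V * (star V * P) = P := by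
      rw [← mul_assoc, mul_assoc P, h₂, mul_one, hPP]
    have h₄ : P * V * (1 - P) = 0 := by
      rw [← hc, mul_assoc, mul_sub, mul_one, hPP, sub_self, mul_zero]
    have h₅ : (1 - P) * (star V * P) = 0 := by
      rw [← hc', ← mul_assoc, sub_mul, one_mul, hPP, sub_self, zero_mul]
    rw [mul_add, add_mul, add_mul, h₃, h₄, h₅, hP.one_sub.eq]
    abel

theorem LinearMap.norm_apply_of_mem_unitary {H : Type*} [NormedAddCommGroup H]
    [InnerProductSpace ℂ H] [FiniteDimensional ℂ H] {T : H →ₗ[ℂ] H}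
    (hT : T ∈ unitary (H →ₗ[ℂ] H)) (x : H) : ‖T x‖ = ‖x‖ := by
  have h : LinearMap.adjoint T (T x) = x := LinearMap.congr_fun (Unitary.mem_iff.1 hT).1 x
  rw [@norm_eq_sqrt_re_inner ℂ, @norm_eq_sqrt_re_inner ℂ _ _ _ _ x,
    ← LinearMap.adjoint_inner_left, h]

/-- If `V - 1 = P * (V - 1)`, then `Q * U ^ m * (U * V) ^ k` applied to `P ψ` is controlled by the
leakage from `P` to `Q` under powers of `U`. -/
theorem norm_apply_pow_mul_pow_le {H : Type*} [NormedAddCommGroup H] [InnerProductSpace ℂ H]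
    {U V P Q : H →ₗ[ℂ] H} (hP : IsIdempotentElem P) (hV : V - 1 = P * (V - 1))
    {ψ : H} {t : ℕ} {ε : ℝ}
    (hε : ∀ q r s : ℕ, q ≤ t → r ≤ t → s ≤ t →
      ‖(Q * U ^ q * P * V ^ r * (U * V) ^ s * P) ψ‖ ≤ ε) (k : ℕ) :
    ∀ m : ℕ, m + k ≤ t → ‖(Q * U ^ m * (U * V) ^ k * P) ψ‖ ≤ (2 * k + 1) * ε := by
  induction k with
  | zero =>
    intro m hm
    have h := hε m 0 0 hm t.zero_le t.zero_le
    simpa only [pow_zero, mul_one, mul_assoc, hP.eq, Nat.cast_zero, mul_zero, zero_add,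
      one_mul] using h
  | succ k ih =>
    intro m hm
    have key : Q * U ^ m * (U * V) ^ (k + 1) * P
        = Q * U ^ (m + 1) * (U * V) ^ k * P
          + (Q * U ^ (m + 1) * P * V ^ 1 * (U * V) ^ k * P
            - Q * U ^ (m + 1) * P * V ^ 0 * (U * V) ^ k * P) := by
      calc Q * U ^ m * (U * V) ^ (k + 1) * P
          = Q * U ^ (m + 1) * (1 + (V - 1)) * (U * V) ^ k * P := by
            rw [pow_succ' (U * V), pow_succ U]; noncomm_ring
        _ = Q * U ^ (m + 1) * (1 + P * (V - 1)) * (U * V) ^ k * P := by rw [← hV]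
        _ = _ := by
            rw [pow_one, pow_zero]
            simp only [mul_add, add_mul, mul_sub, sub_mul, mul_one, mul_assoc]
    have h₁ := hε (m + 1) 1 k (by omega) (by omega) (by omega)
    have h₀ := hε (m + 1) 0 k (by omega) (by omega) (by omega)
    have h := ih (m + 1) (by omega)
    rw [key, LinearMap.add_apply, LinearMap.sub_apply]
    refine (norm_add_le _ _).trans ?_
    refine (add_le_add h ((norm_sub_le _ _).trans (add_le_add h₁ h₀))).trans ?_
    push_cast
    linarith

/-- **Claim 5.8.**
`H` is a finite-dimensional complex inner product space; `P₀, P₁` are orthogonal projections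
with `P₀ * P₁ = 0`; `U, G₀, G₁` are unitaries with `G₀` commuting with `P₀` and `G₁` commuting
with `P₁`; `G = P₀G₀ + P₁G₁ + (1 - (P₀ + P₁))`, `G₀' = P₀G₀ + (1 - P₀)` (this is `G̃₀`);
`ε` is the maximum of `‖P₁ U^q P₀ (G₀')^r (U G₀')^s P₀ ψ‖` over `q, r, s ≤ t`.
Then `‖(U G)^t P₀ ψ - (U G₀')^t P₀ ψ‖ ≤ 2 t² ε`. -/
theorem stmt_2 {H : Type*} [NormedAddCommGroup H] [InnerProductSpace ℂ H]
    [FiniteDimensional ℂ H]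
    (U G₀ G₁ P₀ P₁ : H →ₗ[ℂ] H)
    (hU : U ∈ unitary (H →ₗ[ℂ] H))
    (hG₀ : G₀ ∈ unitary (H →ₗ[ℂ] H))
    (hG₁ : G₁ ∈ unitary (H →ₗ[ℂ] H))
    (hP₀ : IsIdempotentElem P₀) (hP₀sa : IsSelfAdjoint P₀)
    (hP₁ : IsIdempotentElem P₁) (hP₁sa : IsSelfAdjoint P₁)
    (horth : P₀ * P₁ = 0)
    (hc₀ : G₀ * P₀ = P₀ * G₀) (hc₁ : G₁ * P₁ = P₁ * G₁)
    (ψ : H) (hψ : ‖ψ‖ = 1)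
    (G G₀' : H →ₗ[ℂ] H)
    (hG : G = P₀ * G₀ + P₁ * G₁ + (1 - (P₀ + P₁)))
    (hG₀' : G₀' = P₀ * G₀ + (1 - P₀))
    (t : ℕ) (ε : ℝ)
    (hε : ε = sSup {x : ℝ | ∃ q r s : ℕ, q ≤ t ∧ r ≤ t ∧ s ≤ t ∧
      x = ‖(P₁ * U ^ q * P₀ * G₀' ^ r * (U * G₀') ^ s * P₀) ψ‖}) :
    ‖((U * G) ^ t * P₀) ψ - ((U * G₀') ^ t * P₀) ψ‖ ≤ 2 * (t : ℝ) ^ 2 * ε := by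
  have hε' : ∀ q r s : ℕ, q ≤ t → r ≤ t → s ≤ t →
      ‖(P₁ * U ^ q * P₀ * G₀' ^ r * (U * G₀') ^ s * P₀) ψ‖ ≤ ε := by
    intro q r s hq hr hs
    rw [hε]
    refine le_csSup (Set.Finite.bddAbove ?_) ⟨q, r, s, hq, hr, hs, rfl⟩
    refine (((Set.finite_Iic t).prod ((Set.finite_Iic t).prod (Set.finite_Iic t))).image
      fun p : ℕ × ℕ × ℕ =>
        ‖(P₁ * U ^ p.1 * P₀ * G₀' ^ p.2.1 * (U * G₀') ^ p.2.2 * P₀) ψ‖).subset ?_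
    rintro x ⟨q, r, s, hq, hr, hs, rfl⟩
    exact ⟨(q, r, s), ⟨hq, hr, hs⟩, rfl⟩
  have hV : G₀' - 1 = P₀ * (G₀' - 1) := by
    have h : G₀' - 1 = P₀ * (G₀ - 1) := by rw [hG₀']; noncomm_ring
    rw [h, ← mul_assoc, hP₀.eq]
  have hGfactor : G = (P₀ * G₀ + (1 - P₀)) * (P₁ * G₁ + (1 - P₁)) := by
    have h : P₀ * G₀ * P₁ = 0 := by rw [← hc₀, mul_assoc, horth, mul_zero]
    have h₁ : P₀ * G₀ * (P₁ * G₁) = 0 := by rw [← mul_assoc, h, zero_mul]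
    have h₂ : P₀ * (P₁ * G₁) = 0 := by rw [← mul_assoc, horth, zero_mul]
    rw [hG]
    simp only [mul_add, add_mul, mul_sub, sub_mul, mul_one, one_mul, h, h₁, h₂, horth]
    abel
  have hUG : U * G ∈ unitary (H →ₗ[ℂ] H) := by
    rw [hGfactor]
    exact mul_mem hU (mul_mem (mul_add_one_sub_mem_unitary hG₀ hP₀ hP₀sa hc₀)
      (mul_add_one_sub_mem_unitary hG₁ hP₁ hP₁sa hc₁))
  have hdiff : G = G₀' + (G₁ - 1) * P₁ := by
    rw [hG, hG₀', sub_mul, hc₁, one_mul]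
    abel
  have hstep : ∀ n ≤ t,
      ‖((U * G) ^ n * P₀) ψ - ((U * G₀') ^ n * P₀) ψ‖ ≤ 2 * (n : ℝ) ^ 2 * ε := by
    intro n
    induction n with
    | zero => simp
    | succ n ih =>
      intro hn
      have hrec : ((U * G) ^ (n + 1) * P₀) ψ - ((U * G₀') ^ (n + 1) * P₀) ψ
          = (U * G) (((U * G) ^ n * P₀) ψ - ((U * G₀') ^ n * P₀) ψ)
            + U (G₁ ((P₁ * U ^ 0 * (U * G₀') ^ n * P₀) ψ)
              - (P₁ * U ^ 0 * (U * G₀') ^ n * P₀) ψ) := by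
        have hB : (U * G) (((U * G₀') ^ n * P₀) ψ) = (U * G₀') (((U * G₀') ^ n * P₀) ψ)
            + U (G₁ ((P₁ * U ^ 0 * (U * G₀') ^ n * P₀) ψ)
              - (P₁ * U ^ 0 * (U * G₀') ^ n * P₀) ψ) := by
          rw [hdiff]
          simp [Module.End.mul_apply]
        rw [map_sub, hB, pow_succ', pow_succ', mul_assoc, mul_assoc (U * G₀'),
          Module.End.mul_apply (U * G), Module.End.mul_apply (U * G₀')]
        abel
      have hleak := norm_apply_pow_mul_pow_le hP₀ hV hε' n 0 (by omega)
      rw [hrec]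
      refine (norm_add_le _ _).trans ?_
      rw [LinearMap.norm_apply_of_mem_unitary hUG, LinearMap.norm_apply_of_mem_unitary hU]
      refine (add_le_add (ih (by omega)) (norm_sub_le _ _)).trans ?_
      rw [LinearMap.norm_apply_of_mem_unitary hG₁]
      push_cast
      linarith
  exact hstep t le_rfl
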